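/- Let n ≥ 1 be an integer, r₀ > 0, λ > 1, a, b ∈ ℝ, and let I : (0,∞) → (0,∞) be continuous and satisfy λ^{−a} I(r) ≤ I(λ r) ≤ λ^{b} I(r) for every r ∈ [r₀, λ² r₀]. Set J_i = ∫_{r₀}^{λ^i r₀} r^{n−1} I(r) dr for i = 1,2,3. Then J_3 ≤ (1 + λ^{n+b} + λ^{a−n})·(J_2 − J_1). -/

import Mathlib

/-- Annulus comparison: if `I : (0,∞) → (0,∞)` is continuous with
`l^{−a} I(r) ≤ I(l r) ≤ l^{b} I(r)` for all `r ∈ [r₀, l² r₀]`, and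
`J i = ∫_{r₀}^{l^i r₀} r^{n−1} I(r) dr`, then
`J 3 ≤ (1 + l^{n+b} + l^{a−n}) (J 2 − J 1)`. -/
theorem stmt9 (n : ℕ) (hn : 1 ≤ n) (r₀ l a b : ℝ) (hr₀ : 0 < r₀) (hl : 1 < l)
    (I : ℝ → ℝ) (hIcont : ContinuousOn I (Set.Ioi 0)) (hIpos : ∀ r > (0 : ℝ), 0 < I r)
    (hlow : ∀ r ∈ Set.Icc r₀ (l ^ 2 * r₀), l ^ (-a) * I r ≤ I (l * r))
    (hup : ∀ r ∈ Set.Icc r₀ (l ^ 2 * r₀), I (l * r) ≤ l ^ b * I r)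
    (J : ℕ → ℝ)
    (hJ : ∀ i : ℕ, J i = ∫ r in r₀..(l ^ i * r₀), r ^ (n - 1) * I r) :
    J 3 ≤ (1 + l ^ ((n : ℝ) + b) + l ^ (a - (n : ℝ))) * (J 2 - J 1) := by
  have hl0 : 0 < l := by linarith
  set f : ℝ → ℝ := fun r => r ^ (n - 1) * I r with hf
  have hfc : ContinuousOn f (Set.Ioi 0) := (continuous_pow (n - 1)).continuousOn.mul hIcont
  have hint : ∀ x y : ℝ, 0 < x → 0 < y → IntervalIntegrable f MeasureTheory.volume x y := by
    intro x y hx hy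
    apply ContinuousOn.intervalIntegrable
    apply hfc.mono
    intro z hz
    exact lt_of_lt_of_le (lt_min hx hy) hz.1
  have hintl : ∀ x y : ℝ, 0 < x → 0 < y →
      IntervalIntegrable (fun r => f (l * r)) MeasureTheory.volume x y := by
    intro x y hx hy
    apply ContinuousOn.intervalIntegrable
    apply hfc.comp (continuous_const.mul continuous_id).continuousOn
    intro z hz
    exact mul_pos hl0 (lt_of_lt_of_le (lt_min hx hy) hz.1)
  have hln : l * l ^ (n - 1) = l ^ n := by
    rw [← pow_succ', Nat.sub_add_cancel hn]
  have h1 : r₀ ≤ l * r₀ := by nlinarith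
  have h2 : l * r₀ ≤ l ^ 2 * r₀ := by nlinarith [mul_pos hl0 hr₀]
  have p1 : 0 < l * r₀ := by positivity
  have p2 : 0 < l ^ 2 * r₀ := by positivity
  have p3 : 0 < l ^ 3 * r₀ := by positivity
  have e1 : J 1 = ∫ r in r₀..(l * r₀), f r := by rw [hJ, pow_one]
  have e2 : J 2 - J 1 = ∫ r in (l * r₀)..(l ^ 2 * r₀), f r := by
    rw [e1, hJ 2]
    exact intervalIntegral.integral_interval_sub_left (hint _ _ hr₀ p2) (hint _ _ hr₀ p1)
  have e3 : J 3 - J 2 = ∫ r in (l ^ 2 * r₀)..(l ^ 3 * r₀), f r := by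
    rw [hJ 3, hJ 2]
    exact intervalIntegral.integral_interval_sub_left (hint _ _ hr₀ p3) (hint _ _ hr₀ p2)
  have hC : J 3 - J 2 ≤ l ^ ((n : ℝ) + b) * (J 2 - J 1) := by
    have k : J 3 - J 2 = ∫ r in (l * r₀)..(l ^ 2 * r₀), l * f (l * r) := by
      rw [intervalIntegral.integral_const_mul, intervalIntegral.mul_integral_comp_mul_left, e3]
      congr 1 <;> ring
    rw [k, e2, ← intervalIntegral.integral_const_mul]
    apply intervalIntegral.integral_mono_on h2 ((hintl _ _ p1 p2).const_mul l)
      ((hint _ _ p1 p2).const_mul _)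
    intro r hr
    have hr0 : 0 < r := lt_of_lt_of_le p1 hr.1
    have := hup r ⟨h1.trans hr.1, hr.2⟩
    rw [Real.rpow_add hl0, Real.rpow_natCast, ← hln]
    simp only [hf]
    calc l * ((l * r) ^ (n - 1) * I (l * r)) ≤ l * ((l * r) ^ (n - 1) * (l ^ b * I r)) := by
          gcongr
      _ = _ := by rw [mul_pow]; ring
  have hA : l ^ ((n : ℝ) - a) * J 1 ≤ J 2 - J 1 := by
    have k : J 2 - J 1 = ∫ r in r₀..(l * r₀), l * f (l * r) := by
      rw [intervalIntegral.integral_const_mul, intervalIntegral.mul_integral_comp_mul_left, e2]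
      congr 1; ring
    rw [k, e1, ← intervalIntegral.integral_const_mul]
    apply intervalIntegral.integral_mono_on h1 ((hint _ _ hr₀ p1).const_mul _)
      ((hintl _ _ hr₀ p1).const_mul l)
    intro r hr
    have hr0 : 0 < r := lt_of_lt_of_le hr₀ hr.1
    have := hlow r ⟨hr.1, hr.2.trans h2⟩
    rw [sub_eq_add_neg, Real.rpow_add hl0, Real.rpow_natCast, ← hln]
    simp only [hf]
    calc _ = l * ((l * r) ^ (n - 1) * (l ^ (-a) * I r)) := by rw [mul_pow]; ring
      _ ≤ l * ((l * r) ^ (n - 1) * I (l * r)) := by gcongr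
  have hA' : J 1 ≤ l ^ (a - (n : ℝ)) * (J 2 - J 1) := by
    have hm := mul_le_mul_of_nonneg_left hA (Real.rpow_pos_of_pos hl0 (a - (n : ℝ))).le
    rw [← mul_assoc, ← Real.rpow_add hl0] at hm
    simpa using hm
  linarith
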